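/- arXiv:0705.2436 — 3 statements merged into one kernel-verified Lean document; each statement's English description precedes it below -/
import Mathlib

section
/- Let > be a monomial ordering on Mon^s(z_1,…,z_d) and let Δ_> = {(γ, e_i) − (γ', e_j) ∈ ℤ^{d+s} : z^γ e_i > z^{γ'} e_j}, where (γ, e_i) ∈ ℕ^{d+s} denotes the concatenation of γ with the i-th standard basis vector of ℕ^s. Then the zero vector of ℤ^{d+s} cannot be written as a sum n_1·δ_1 + … + n_k·δ_k with k ≥ 1, δ_1, …, δ_k ∈ Δ_> and n_1, …, n_k positive integers. -/
/-- A (module) monomial `z^γ e_i` of `Mon^s(z_1,…,z_d)`, encoded by its exponent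
vector `γ ∈ ℕ^d` and its component `i`. -/
abbrev MonZ (d s : ℕ) := (Fin d →₀ ℕ) × Fin s

/-- A monomial ordering on `Mon^s(z_1,…,z_d)`:  a strict total order compatible with
the action of `Mon(z_1,…,z_d)` and independent of the module component. -/
structure MonOrder (d s : ℕ) where
  lt : MonZ d s → MonZ d s → Prop
  irrefl : ∀ μ, ¬ lt μ μ
  trans : ∀ {μ ν ρ}, lt μ ν → lt ν ρ → lt μ ρ
  total : ∀ μ ν, μ = ν ∨ lt μ ν ∨ lt ν μ
  add_compat : ∀ (γ γ' γ'' : Fin d →₀ ℕ) (i j : Fin s),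
    lt (γ, i) (γ', j) → lt (γ + γ'', i) (γ' + γ'', j)
  comp_indep : ∀ (γ γ' : Fin d →₀ ℕ) (i j : Fin s),
    lt (γ, i) (γ', i) → lt (γ, j) (γ', j)

/-- The set `Δ_> = {(γ,e_i) − (γ',e_j) ∈ ℤ^{d+s} : z^γ e_i > z^{γ'} e_j}`, where
`(γ,e_i)` denotes the concatenation of `γ` with the `i`-th standard basis vector. -/
def deltaSet {d s : ℕ} (o : MonOrder d s) : Set ((Fin d → ℤ) × (Fin s → ℤ)) :=
  {v | ∃ (γ γ' : Fin d →₀ ℕ) (i j : Fin s), o.lt (γ', j) (γ, i) ∧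
      v = (fun l => (γ l : ℤ) - (γ' l : ℤ),
           fun i' => (if i' = i then 1 else 0) - (if i' = j then 1 else 0))}

namespace MonOrder

variable {d s : ℕ} (o : MonOrder d s)

/-- Comparisons of pure monomials, read in any module component, add up. -/
theorem lt_add {a b a' b' : Fin d →₀ ℕ} {i j k : Fin s}
    (h : o.lt (b, i) (a, j)) (h' : o.lt (b', j) (a', k)) :
    o.lt (b + b', i) (a + a', k) := by
  have h1 := o.add_compat _ _ b' _ _ h
  have h2 := o.add_compat _ _ a _ _ h'
  rw [add_comm b' a, add_comm a' a] at h2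
  exact o.trans h1 h2

/-- A nonempty multiset of comparisons `r.1 > r.2` in which the components on both sides
agree as multisets multiplies to a comparison of pure monomials. -/
theorem sum_lt_sum_of_balanced (m : Multiset (MonZ d s × MonZ d s)) (hm : m ≠ 0)
    (hlt : ∀ r ∈ m, o.lt r.2 r.1)
    (hbal : m.map (fun r => r.1.2) = m.map (fun r => r.2.2)) (k : Fin s) :
    o.lt ((m.map fun r => r.2.1).sum, k) ((m.map fun r => r.1.1).sum, k) := by
  induction hn : m.card generalizing m with
  | zero => exact absurd (Multiset.card_eq_zero.1 hn) hm
  | succ n ih =>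
    obtain ⟨⟨⟨a, i⟩, ⟨b, j⟩⟩, hr⟩ := Multiset.exists_mem_of_ne_zero hm
    obtain ⟨m, rfl⟩ := Multiset.exists_cons_of_mem hr
    clear hr
    have hab : o.lt (b, j) (a, i) := hlt _ (Multiset.mem_cons_self _ _)
    simp only [Multiset.card_cons, Nat.add_right_cancel_iff] at hn
    simp only [Multiset.map_cons, Multiset.sum_cons] at hbal ⊢
    by_cases hij : i = j
    · subst hij
      have hab' := o.comp_indep _ _ _ k hab
      rcases eq_or_ne m 0 with rfl | hm0
      · simpa using hab'
      · exact o.lt_add hab' (ih m hm0 (fun r hr => hlt r (Multiset.mem_cons_of_mem hr))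
          ((Multiset.cons_inj_right _).1 hbal) hn)
    · have hj : j ∈ i ::ₘ m.map (fun r => r.1.2) := hbal ▸ Multiset.mem_cons_self _ _
      obtain ⟨⟨⟨a', j'⟩, ⟨b', l⟩⟩, hr, rfl⟩ :=
        Multiset.mem_map.1 ((Multiset.mem_cons.1 hj).resolve_left (Ne.symm hij))
      obtain ⟨m, rfl⟩ := Multiset.exists_cons_of_mem hr
      have hab' : o.lt (b', l) (a', j') :=
        hlt _ (Multiset.mem_cons_of_mem (Multiset.mem_cons_self _ _))
      have key := ih (((a' + a, i), (b' + b, l)) ::ₘ m) (Multiset.cons_ne_zero)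
        (fun r hr => by
          rcases Multiset.mem_cons.1 hr with rfl | hr
          · exact o.lt_add hab' hab
          · exact hlt r (Multiset.mem_cons_of_mem (Multiset.mem_cons_of_mem hr)))
        (by
          simp only [Multiset.map_cons] at hbal ⊢
          rw [Multiset.cons_swap] at hbal
          exact (Multiset.cons_inj_right _).1 hbal)
        (by simpa using hn)
      simp only [Multiset.map_cons, Multiset.sum_cons] at key ⊢
      rwa [add_comm b' b, add_comm a' a, add_assoc, add_assoc] at key

end MonOrder

/-- **Lemma (Bayer).**  The zero vector of `ℤ^{d+s}` is not a positive integer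
combination of elements of `Δ_>`. -/
theorem statement2 {d s : ℕ} (o : MonOrder d s) :
    ¬ ∃ (k : ℕ) (δ : Fin k → (Fin d → ℤ) × (Fin s → ℤ)) (c : Fin k → ℤ),
        0 < k ∧ (∀ i, δ i ∈ deltaSet o) ∧ (∀ i, 0 < c i) ∧
        (∑ i, c i • δ i) = (0 : (Fin d → ℤ) × (Fin s → ℤ)) := by
  rintro ⟨k, δ, c, hk, hδ, hc, hsum⟩
  choose a b i j hlt hδ using hδ
  lift c to Fin k → ℕ using fun t => (hc t).le
  have hfst : ∑ t, c t • a t = ∑ t, c t • b t := by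
    ext l
    have h := congrFun (congrArg Prod.fst hsum) l
    simp only [hδ, Prod.fst_sum, Prod.smul_fst, Finset.sum_apply, Pi.smul_apply, smul_eq_mul,
      Prod.fst_zero, Pi.zero_apply, mul_sub, Finset.sum_sub_distrib, sub_eq_zero] at h
    simp only [Finsupp.finsetSum_apply, Finsupp.smul_apply, smul_eq_mul]
    exact_mod_cast h
  have hsnd : ∑ t, c t • ({i t} : Multiset (Fin s)) = ∑ t, c t • {j t} := by
    ext l
    have h := congrFun (congrArg Prod.snd hsum) l
    simp only [hδ, Prod.snd_sum, Prod.smul_snd, Finset.sum_apply, Pi.smul_apply, smul_eq_mul,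
      Prod.snd_zero, Pi.zero_apply, mul_sub, Finset.sum_sub_distrib, sub_eq_zero] at h
    simp only [Multiset.count_sum', Multiset.count_nsmul, Multiset.count_singleton]
    exact_mod_cast h
  let r : Fin k → MonZ d s × MonZ d s := fun t => ((a t, i t), (b t, j t))
  let m : Multiset (MonZ d s × MonZ d s) := ∑ t, c t • {r t}
  have hmap {β : Type} (f : MonZ d s × MonZ d s → β) : m.map f = ∑ t, c t • {f (r t)} := by
    refine (map_sum (Multiset.mapAddMonoidHom f) _ _).trans (Finset.sum_congr rfl fun t _ => ?_)
    simp [Multiset.map_nsmul]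
  have hmsum (f : MonZ d s × MonZ d s → Fin d →₀ ℕ) :
      (m.map f).sum = ∑ t, c t • f (r t) := by
    rw [hmap]
    refine (map_sum Multiset.sumAddMonoidHom _ _).trans (Finset.sum_congr rfl fun t _ => ?_)
    simp [Multiset.sum_nsmul]
  have hmem : r ⟨0, hk⟩ ∈ m := Multiset.mem_sum.2 ⟨⟨0, hk⟩, Finset.mem_univ _,
    Multiset.mem_nsmul.2 ⟨Int.natCast_ne_zero.1 (hc ⟨0, hk⟩).ne', Multiset.mem_singleton_self _⟩⟩
  have key := o.sum_lt_sum_of_balanced m (fun h => by simp [h] at hmem)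
    (fun x hx => by
      obtain ⟨t, -, ht⟩ := Multiset.mem_sum.1 hx
      rw [Multiset.mem_singleton.1 (Multiset.mem_of_mem_nsmul ht)]
      exact hlt t)
    (by rw [hmap, hmap]; exact hsnd) (i ⟨0, hk⟩)
  rw [hmsum, hmsum] at key
  change o.lt (∑ t, c t • b t, _) (∑ t, c t • a t, _) at key
  rw [hfst] at key
  exact o.irrefl _ key
end

section
/- Let > be a monomial ordering on Mon^s(z_1,…,z_d) and M ⊆ Mon^s(z_1,…,z_d) a finite set. Then there exists w ∈ ℤ^{d+s} with w_i < 0 whenever z_i e_1 < e_1 and w_i > 0 whenever z_i e_1 > e_1 (for 1 ≤ i ≤ d), such that for all z^γ e_i, z^{γ'} e_j ∈ M one has z^γ e_i > z^{γ'} e_j if and only if w·(γ, e_i) > w·(γ', e_j), where (γ, e_i) ∈ ℕ^{d+s} denotes the concatenation of γ with the i-th standard basis vector of ℕ^s and · is the standard scalar product. -/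
/-- The scalar product `w·(γ, e_i)` of `w ∈ ℤ^{d+s}` with the concatenation of
`γ ∈ ℕ^d` and the `i`-th standard basis vector of `ℕ^s`. -/
def wdotZ {d s : ℕ} (w : (Fin d → ℤ) × (Fin s → ℤ)) (μ : MonZ d s) : ℤ :=
  (∑ l, w.1 l * (μ.1 l : ℤ)) + w.2 μ.2

theorem AddSubsemigroup.zsmul_mem_of_pos {G : Type*} [AddGroup G] (S : AddSubsemigroup G)
    {x : G} (hx : x ∈ S) {a : ℤ} (ha : 0 < a) : a • x ∈ S := by
  induction a, Int.add_one_le_iff.2 ha using Int.leInduction with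
  | base => simpa using hx
  | succ k hk ih =>
    rw [add_zsmul, one_zsmul]
    exact S.add_mem (ih (by omega)) hx

/-- **Gordan's alternative** over the integers: a finite set of integer vectors either lies in an
open half-space with integral normal vector, or the semigroup it generates contains `0`. -/
theorem exists_dotProduct_pos_or_zero_mem_closure {n : ℕ} (V : Finset (Fin n → ℤ)) :
    (∃ w : Fin n → ℤ, ∀ v ∈ V, 0 < ∑ i, w i * v i) ∨
      (0 : Fin n → ℤ) ∈ AddSubsemigroup.closure (V : Set (Fin n → ℤ)) := by
  classical
  induction n with
  | zero =>
    rcases V.eq_empty_or_nonempty with rfl | ⟨v, hv⟩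
    · exact Or.inl ⟨0, by simp⟩
    · exact Or.inr (AddSubsemigroup.subset_closure (by rwa [Subsingleton.elim 0 v]))
  | succ n ih =>
    let W : Finset (Fin n → ℤ) :=
      (V.filter (fun v => v 0 = 0)).image Fin.tail ∪
        ((V.filter (fun v => 0 < v 0)) ×ˢ (V.filter (fun v => v 0 < 0))).image
          (fun x => x.1 0 • Fin.tail x.2 + (-x.2 0) • Fin.tail x.1)
    rcases ih W with ⟨w, hw⟩ | h0
    · left
      let f : (Fin (n + 1) → ℤ) → ℤ := fun v => ∑ i, w i * v i.succ
      have hzero : ∀ v ∈ V, v 0 = 0 → 0 < f v := fun v hv h =>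
        hw _ (Finset.mem_union_left _ (Finset.mem_image.2 ⟨v, by simp [hv, h], rfl⟩))
      have hpair : ∀ p ∈ V, 0 < p 0 → ∀ q ∈ V, q 0 < 0 → 0 < p 0 * f q + (-q 0) * f p := by
        intro p hp hp0 q hq hq0
        have := hw _ (Finset.mem_union_right _
          (Finset.mem_image.2 ⟨(p, q), by simp [hp, hq, hp0, hq0], rfl⟩))
        convert this using 1
        simp only [f, Finset.mul_sum, ← Finset.sum_add_distrib]
        refine Finset.sum_congr rfl fun i _ => ?_
        simp only [Pi.add_apply, Pi.smul_apply, Fin.tail, smul_eq_mul]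
        ring
      obtain ⟨r, hlo, hhi⟩ := Order.exists_between_finsets
        ((V.filter (fun v => 0 < v 0)).image (fun p => -(f p : ℚ) / (p 0 : ℚ)))
        ((V.filter (fun v => v 0 < 0)).image (fun q => (f q : ℚ) / (-q 0 : ℚ))) (by
          simp only [Finset.mem_image, Finset.mem_filter]
          rintro _ ⟨p, ⟨hp, hp0⟩, rfl⟩ _ ⟨q, ⟨hq, hq0⟩, rfl⟩
          have h1 : (0 : ℚ) < p 0 := by exact_mod_cast hp0
          have h2 : (0 : ℚ) < -q 0 := by exact_mod_cast neg_pos.2 hq0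
          have h3 : (0 : ℚ) < p 0 * f q + (-q 0) * f p := by
            exact_mod_cast hpair p hp hp0 q hq hq0
          rw [div_lt_div_iff₀ h1 h2]
          linarith)
      have hden : (0 : ℚ) < r.den := by exact_mod_cast r.den_pos
      refine ⟨Fin.cons r.num (fun i => (r.den : ℤ) * w i), fun v hv => ?_⟩
      have hsum : ∑ i, (Fin.cons r.num (fun i => (r.den : ℤ) * w i) : Fin (n + 1) → ℤ) i * v i
          = r.num * v 0 + r.den * f v := by
        simp [Fin.sum_univ_succ, f, Finset.mul_sum, mul_assoc]
      have hcast : ((r.num * v 0 + r.den * f v : ℤ) : ℚ) = r.den * (r * v 0 + f v) := by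
        push_cast
        rw [mul_add, ← mul_assoc, Rat.den_mul_eq_num]
      rw [hsum, ← Int.cast_pos (R := ℚ), hcast]
      refine mul_pos hden ?_
      rcases lt_trichotomy (v 0) 0 with h | h | h
      · have := hhi _ (Finset.mem_image.2 ⟨v, by simp [hv, h], rfl⟩)
        rw [lt_div_iff₀ (by exact_mod_cast neg_pos.2 h)] at this
        linarith
      · have := hzero v hv h
        simpa [h] using this
      · have := hlo _ (Finset.mem_image.2 ⟨v, by simp [hv, h], rfl⟩)
        rw [div_lt_iff₀ (by exact_mod_cast h)] at this
        linarith
    · right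
      suffices H : ∀ x ∈ AddSubsemigroup.closure (W : Set (Fin n → ℤ)),
          (Fin.cons 0 x : Fin (n + 1) → ℤ) ∈
            AddSubsemigroup.closure (V : Set (Fin (n + 1) → ℤ)) by
        convert H 0 h0 using 1
        ext i
        refine Fin.cases ?_ (fun j => ?_) i <;> simp
      intro x hx
      induction hx using AddSubsemigroup.closure_induction with
      | mem x hx =>
        rcases Finset.mem_union.1 hx with hx | hx
        · obtain ⟨v, hv, rfl⟩ := Finset.mem_image.1 hx
          obtain ⟨hv, h⟩ := Finset.mem_filter.1 hv
          rw [← h, Fin.cons_self_tail]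
          exact AddSubsemigroup.subset_closure hv
        · obtain ⟨⟨p, q⟩, hpq, rfl⟩ := Finset.mem_image.1 hx
          simp only [Finset.mem_product, Finset.mem_filter] at hpq
          obtain ⟨⟨hp, hp0⟩, hq, hq0⟩ := hpq
          convert AddSubsemigroup.add_mem _
            (AddSubsemigroup.zsmul_mem_of_pos _ (AddSubsemigroup.subset_closure hq) hp0)
            (AddSubsemigroup.zsmul_mem_of_pos _ (AddSubsemigroup.subset_closure hp)
              (neg_pos.2 hq0)) using 1
          ext i
          refine Fin.cases ?_ (fun j => ?_) i
          · simp [mul_comm]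
          · simp [Fin.tail]
      | add x y _ _ hx hy =>
        convert AddSubsemigroup.add_mem _ hx hy using 1
        ext i
        refine Fin.cases ?_ (fun j => ?_) i <;> simp

/-- The concatenation `(γ, e_i) ∈ ℤ^{d+s}` of the exponent and the component of `z^γ e_i`. -/
def MonZ.toVec {d s : ℕ} (μ : MonZ d s) : Fin (d + s) → ℤ :=
  Fin.append (fun l => (μ.1 l : ℤ)) (Pi.single μ.2 1)

namespace MonZ

variable {d s : ℕ}

@[simp] theorem toVec_castAdd (μ : MonZ d s) (l : Fin d) :
    μ.toVec (Fin.castAdd s l) = μ.1 l := by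
  simp [toVec]

@[simp] theorem toVec_natAdd (μ : MonZ d s) (i : Fin s) :
    μ.toVec (Fin.natAdd d i) = if i = μ.2 then 1 else 0 := by
  simp [toVec, Pi.single_apply]

theorem toVec_injective : Function.Injective (toVec : MonZ d s → Fin (d + s) → ℤ) := by
  intro μ ν h
  refine Prod.ext (Finsupp.ext fun l => ?_) ?_
  · simpa using congrFun h (Fin.castAdd s l)
  · by_contra hne
    simpa [hne] using congrFun h (Fin.natAdd d μ.2)

theorem toVec_add_sub_toVec_add (γ γ' δ δ' : Fin d →₀ ℕ) (i j k : Fin s) :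
    toVec (γ + δ, i) - toVec (γ' + δ', k) =
      (toVec (γ, i) - toVec (γ', j)) + (toVec (δ, j) - toVec (δ', k)) := by
  ext l
  refine Fin.addCases (fun l => ?_) (fun l => ?_) l
  · simp
    ring
  · simp

theorem toVec_add_sub_toVec_add_self (γ γ' δ δ' : Fin d →₀ ℕ) (i j k : Fin s) :
    toVec (γ + δ, j) - toVec (γ' + δ', k) =
      (toVec (γ, i) - toVec (γ', i)) + (toVec (δ, j) - toVec (δ', k)) := by
  ext l
  refine Fin.addCases (fun l => ?_) (fun l => ?_) l
  · simp
    ring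
  · simp

theorem wdotZ_eq_sum_toVec (w : Fin (d + s) → ℤ) (μ : MonZ d s) :
    wdotZ (fun l => w (Fin.castAdd s l), fun i => w (Fin.natAdd d i)) μ =
      ∑ k, w k * μ.toVec k := by
  simp [wdotZ, Fin.sum_univ_add]

end MonZ

namespace MonOrder

variable {d s : ℕ} (o : MonOrder d s)

theorem lt_add_of_lt_of_lt {γ γ' δ δ' : Fin d →₀ ℕ} {i j k : Fin s}
    (h : o.lt (γ', j) (γ, i)) (h' : o.lt (δ', k) (δ, j)) : o.lt (γ' + δ', k) (γ + δ, i) := by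
  refine o.trans ?_ (o.add_compat _ _ δ _ _ h)
  simpa only [add_comm γ'] using o.add_compat _ _ γ' _ _ h'

/-- A nonempty sum of differences of exponent vectors of strictly comparable monomials is never
zero. -/
theorem sum_toVec_sub_ne_zero (L : Multiset (MonZ d s × MonZ d s)) (hL : L ≠ 0)
    (hlt : ∀ p ∈ L, o.lt p.1 p.2) : (L.map fun p => p.2.toVec - p.1.toVec).sum ≠ 0 := by
  induction hn : Multiset.card L generalizing L with
  | zero => exact absurd (Multiset.card_eq_zero.1 hn) hL
  | succ n ih =>
    obtain ⟨p, hp⟩ := Multiset.exists_mem_of_ne_zero hL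
    obtain ⟨R, rfl⟩ := Multiset.exists_cons_of_mem hp
    obtain ⟨⟨γ', j⟩, ⟨γ, i⟩⟩ := p
    have hlt0 : o.lt (γ', j) (γ, i) := hlt _ hp
    intro hsum
    rw [Multiset.map_cons, Multiset.sum_cons] at hsum
    have merge : ∀ q r : MonZ d s × MonZ d s, q ∈ R → o.lt r.1 r.2 →
        r.2.toVec - r.1.toVec =
          (MonZ.toVec (γ, i) - MonZ.toVec (γ', j)) + (q.2.toVec - q.1.toVec) → False := by
      intro q r hq hr heq
      obtain ⟨T, rfl⟩ := Multiset.exists_cons_of_mem hq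
      refine ih (r ::ₘ T) (Multiset.cons_ne_zero) (fun t ht => ?_) (by simpa using hn) ?_
      · rcases Multiset.mem_cons.1 ht with rfl | ht
        · exact hr
        · exact hlt t (Multiset.mem_cons_of_mem (Multiset.mem_cons_of_mem ht))
      · rw [Multiset.map_cons, Multiset.sum_cons] at hsum ⊢
        rw [heq, add_assoc, hsum]
    by_cases hij : i = j
    · subst hij
      rcases R.empty_or_exists_mem with rfl | ⟨⟨⟨δ', k⟩, ⟨δ, j⟩⟩, hq⟩
      · rw [Multiset.map_zero, Multiset.sum_zero, add_zero, sub_eq_zero] at hsum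
        have heq : ((γ, i) : MonZ d s) = (γ', i) := MonZ.toVec_injective hsum
        exact o.irrefl _ (heq ▸ hlt0)
      · exact merge _ ((γ' + δ', k), (γ + δ, j)) hq
          (o.lt_add_of_lt_of_lt (o.comp_indep _ _ _ j hlt0)
            (hlt _ (Multiset.mem_cons_of_mem hq)))
          (MonZ.toVec_add_sub_toVec_add_self γ γ' δ δ' i j k)
    · by_cases hex : ∃ q ∈ R, q.2.2 = j
      · obtain ⟨⟨⟨δ', k⟩, ⟨δ, _⟩⟩, hq, rfl⟩ := hex
        exact merge _ ((γ' + δ', k), (γ + δ, i)) hq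
          (o.lt_add_of_lt_of_lt hlt0 (hlt _ (Multiset.mem_cons_of_mem hq)))
          (MonZ.toVec_add_sub_toVec_add γ γ' δ δ' i _ k)
      · push Not at hex
        have hle : (R.map fun p => p.2.toVec - p.1.toVec).sum (Fin.natAdd d j) ≤ 0 := by
          refine (AddMonoidHom.map_multiset_sum
            (Pi.evalAddMonoidHom (fun _ : Fin (d + s) => ℤ) (Fin.natAdd d j)) _).trans_le ?_
          rw [Multiset.map_map]
          refine (Multiset.sum_le_card_nsmul _ 0 ?_).trans_eq (nsmul_zero _)
          simp only [Multiset.mem_map]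
          rintro _ ⟨q, hq, rfl⟩
          simp only [Function.comp_apply, Pi.evalAddMonoidHom_apply, Pi.sub_apply,
            MonZ.toVec_natAdd, if_neg (hex q hq).symm]
          split_ifs <;> simp
        have := congrFun hsum (Fin.natAdd d j)
        simp only [Pi.add_apply, Pi.sub_apply, MonZ.toVec_natAdd, if_neg (Ne.symm hij), if_true,
          Pi.zero_apply] at this
        omega

/-- A monomial ordering is realised by an integral weight vector on every finite set. -/
theorem exists_weight (F : Finset (MonZ d s)) :
    ∃ w : (Fin d → ℤ) × (Fin s → ℤ),
      ∀ μ ∈ F, ∀ ν ∈ F, (o.lt ν μ ↔ wdotZ w ν < wdotZ w μ) := by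
  classical
  let P : Finset (MonZ d s × MonZ d s) := (F ×ˢ F).filter fun p => o.lt p.1 p.2
  rcases exists_dotProduct_pos_or_zero_mem_closure
    (P.image fun p => p.2.toVec - p.1.toVec) with ⟨w, hw⟩ | h0
  · refine ⟨(fun l => w (Fin.castAdd s l), fun i => w (Fin.natAdd d i)), ?_⟩
    have key : ∀ μ ∈ F, ∀ ν ∈ F, o.lt ν μ → ∑ k, w k * ν.toVec k < ∑ k, w k * μ.toVec k := by
      intro μ hμ ν hν h
      have := hw _ (Finset.mem_image.2 ⟨(ν, μ), by simp [P, hμ, hν, h], rfl⟩)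
      simpa [mul_sub] using this
    intro μ hμ ν hν
    simp only [MonZ.wdotZ_eq_sum_toVec]
    refine ⟨key μ hμ ν hν, fun h => ?_⟩
    rcases o.total ν μ with rfl | h' | h'
    · exact absurd h (lt_irrefl _)
    · exact h'
    · exact absurd h (key ν hν μ hμ h').asymm
  · exfalso
    suffices H : ∀ x ∈ AddSubsemigroup.closure
        ((P.image fun p => p.2.toVec - p.1.toVec : Finset _) : Set (Fin (d + s) → ℤ)),
        ∃ L : Multiset (MonZ d s × MonZ d s), L ≠ 0 ∧ (∀ p ∈ L, o.lt p.1 p.2) ∧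
          (L.map fun p => p.2.toVec - p.1.toVec).sum = x by
      obtain ⟨L, hL, hlt, hsum⟩ := H 0 h0
      exact o.sum_toVec_sub_ne_zero L hL hlt hsum
    intro x hx
    induction hx using AddSubsemigroup.closure_induction with
    | mem x hx =>
      obtain ⟨p, hp, rfl⟩ := Finset.mem_image.1 hx
      exact ⟨{p}, by simp, by simpa using (Finset.mem_filter.1 hp).2, by simp⟩
    | add x y _ _ hx hy =>
      obtain ⟨L, hL, hlt, rfl⟩ := hx
      obtain ⟨L', -, hlt', rfl⟩ := hy
      refine ⟨L + L', by simp [hL], fun p hp => ?_, by simp⟩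
      exact (Multiset.mem_add.1 hp).elim (hlt p) (hlt' p)

end MonOrder

/-- **Lemma.**  For every finite set `M` of monomials there is an integer weight vector
`w ∈ ℤ^{d+s}`, with `w_i < 0` whenever `z_i e_1 < e_1` and `w_i > 0` whenever
`z_i e_1 > e_1`, realising the monomial ordering `>` on `M`. -/
theorem statement3 {d s : ℕ} (hs : 0 < s) (o : MonOrder d s)
    (M : Set (MonZ d s)) (hM : M.Finite) :
    ∃ w : (Fin d → ℤ) × (Fin s → ℤ),
      (∀ l : Fin d,
        o.lt (Finsupp.single l 1, (⟨0, hs⟩ : Fin s)) ((0 : Fin d →₀ ℕ), (⟨0, hs⟩ : Fin s)) →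
          w.1 l < 0) ∧
      (∀ l : Fin d,
        o.lt ((0 : Fin d →₀ ℕ), (⟨0, hs⟩ : Fin s)) (Finsupp.single l 1, (⟨0, hs⟩ : Fin s)) →
          0 < w.1 l) ∧
      (∀ μ ∈ M, ∀ ν ∈ M, (o.lt ν μ ↔ wdotZ w ν < wdotZ w μ)) := by
  classical
  let F : Finset (MonZ d s) := hM.toFinset ∪
    insert (0, ⟨0, hs⟩) (Finset.univ.image fun l => (Finsupp.single l 1, ⟨0, hs⟩))
  have hone : ((0, ⟨0, hs⟩) : MonZ d s) ∈ F := by simp [F]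
  have hvar : ∀ l : Fin d, ((Finsupp.single l 1, ⟨0, hs⟩) : MonZ d s) ∈ F := fun l => by simp [F]
  obtain ⟨w, hw⟩ := o.exists_weight F
  have hwvar : ∀ l : Fin d, wdotZ w (Finsupp.single l 1, ⟨0, hs⟩) =
      w.1 l + wdotZ w (0, ⟨0, hs⟩) := by
    intro l
    simp [wdotZ, Finsupp.single_apply]
  refine ⟨w, fun l hl => ?_, fun l hl => ?_, fun μ hμ ν hν => ?_⟩
  · have := (hw _ hone _ (hvar l)).1 hl
    rw [hwvar] at this
    linarith
  · have := (hw _ (hvar l) _ hone).1 hl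
    rw [hwvar] at this
    linarith
  · exact hw μ (by simp [F, hμ]) ν (by simp [F, hν])
end

section
/- Let K be a field, f_1, …, f_k ∈ K[t, x_1,…,x_n] polynomials, and let I = ⟨f_1,…,f_k⟩ be the ideal they generate in K[t]_{⟨t⟩}[x_1,…,x_n], the polynomial ring in x over the localization of K[t] at the maximal ideal ⟨t⟩. Let ι : K[t]_{⟨t⟩}[x_1,…,x_n] → K[[t]][x_1,…,x_n] be the canonical inclusion into the polynomial ring over the formal power series ring. Then ⟨ι(I)⟩ : ⟨t⟩^∞ = ⟨ι(I : ⟨t⟩^∞)⟩, i.e., the saturation with respect to t of the extension of I to K[[t]][x] equals the extension to K[[t]][x] of the saturation of I with respect to t. -/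
/-- The saturation `I : ⟨a⟩^∞ = {f : a^k·f ∈ I for some k ≥ 0}` of an ideal `I` with
respect to an element `a`. -/
def satIdeal {R : Type*} [CommRing R] (I : Ideal R) (a : R) : Ideal R where
  carrier := {f | ∃ k : ℕ, a ^ k * f ∈ I}
  zero_mem' := ⟨0, by simp⟩
  add_mem' := by
    rintro f g ⟨k, hk⟩ ⟨l, hl⟩
    refine ⟨k + l, ?_⟩
    have h : a ^ (k + l) * (f + g) = a ^ l * (a ^ k * f) + a ^ k * (a ^ l * g) := by ring
    rw [h]
    exact I.add_mem (I.mul_mem_left _ hk) (I.mul_mem_left _ hl)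
  smul_mem' := by
    rintro c f ⟨k, hk⟩
    refine ⟨k, ?_⟩
    have h : a ^ k * (c • f) = c * (a ^ k * f) := by simp [smul_eq_mul]; ring
    rw [h]
    exact I.mul_mem_left _ hk

/-- The multiplicative set `K[t] ∖ ⟨t⟩` of polynomials with nonzero constant term;
localizing `K[t]` at it yields `K[t]_{⟨t⟩}`. -/
def constUnitSubmonoid (K : Type*) [Field K] : Submonoid (Polynomial K) where
  carrier := {p | p.coeff 0 ≠ 0}
  one_mem' := by simp
  mul_mem' := by
    intro a b ha hb
    simpa [Polynomial.mul_coeff_zero] using mul_ne_zero ha hb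

/-- Modulo any power of `φ a`, every element of the extension of `I` along `φ` comes from `I`,
provided that `φ` has dense image for the `φ a`-adic topology. -/
theorem exists_mem_add_pow_mul_of_mem_map {R T : Type*} [CommRing R] [CommRing T] (φ : R →+* T)
    (a : R) (k : ℕ) (hdense : ∀ p : T, ∃ (r : R) (q : T), p = φ r + φ a ^ k * q)
    (I : Ideal R) {y : T} (hy : y ∈ I.map φ) :
    ∃ h ∈ I, ∃ z ∈ I.map φ, y = φ h + φ a ^ k * z := by
  refine Submodule.span_induction (p := fun y _ => ∃ h ∈ I, ∃ z ∈ I.map φ, y = φ h + φ a ^ k * z)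
    ?_ ?_ ?_ ?_ hy
  · rintro _ ⟨h, hh, rfl⟩
    exact ⟨h, hh, 0, zero_mem _, by simp⟩
  · exact ⟨0, zero_mem _, 0, zero_mem _, by simp⟩
  · rintro _ _ _ _ ⟨h, hh, z, hz, rfl⟩ ⟨h', hh', z', hz', rfl⟩
    exact ⟨h + h', add_mem hh hh', z + z', add_mem hz hz', by rw [map_add]; ring⟩
  · rintro c _ _ ⟨h, hh, z, hz, rfl⟩
    obtain ⟨r, q, rfl⟩ := hdense c
    refine ⟨r * h, I.mul_mem_left _ hh, q * φ h + (φ r + φ a ^ k * q) * z,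
      add_mem (Ideal.mul_mem_left _ _ (Ideal.mem_map_of_mem φ hh)) (Ideal.mul_mem_left _ _ hz), ?_⟩
    rw [smul_eq_mul, map_mul]
    ring

/-- Saturation commutes with extension along a ring homomorphism inducing isomorphisms modulo
all powers of the saturating element. -/
theorem satIdeal_map_eq_map_satIdeal {R T : Type*} [CommRing R] [CommRing T] (φ : R →+* T)
    (a : R) (hreg : IsLeftRegular (φ a))
    (hdense : ∀ (k : ℕ) (p : T), ∃ (r : R) (q : T), p = φ r + φ a ^ k * q)
    (hdvd : ∀ (k : ℕ) (r : R), φ a ^ k ∣ φ r → a ^ k ∣ r) (I : Ideal R) :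
    satIdeal (I.map φ) (φ a) = (satIdeal I a).map φ := by
  apply le_antisymm
  · rintro g ⟨k, hk⟩
    obtain ⟨h, hh, z, hz, e⟩ := exists_mem_add_pow_mul_of_mem_map φ a k (hdense k) I hk
    obtain ⟨h', rfl⟩ := hdvd k h ⟨g - z, by rw [mul_sub, e]; ring⟩
    have hg : g = φ h' + z := by
      apply hreg.pow k
      change φ a ^ k * g = φ a ^ k * (φ h' + z)
      rw [e, map_mul, map_pow, mul_add]
    rw [hg]
    have hle : I ≤ satIdeal I a := fun x hx => ⟨0, by simpa using hx⟩
    exact add_mem (Ideal.mem_map_of_mem φ ⟨k, hh⟩) (Ideal.map_mono hle hz)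
  · rw [Ideal.map_le_iff_le_comap]
    rintro x ⟨k, hk⟩
    exact ⟨k, by simpa using Ideal.mem_map_of_mem φ hk⟩

theorem MvPolynomial.exists_eq_map_add_C_mul {σ A P : Type*} [CommRing A] [CommRing P]
    (j : A →+* P) (b : P) (h : ∀ p : P, ∃ (r : A) (q : P), p = j r + b * q)
    (p : MvPolynomial σ P) :
    ∃ (r : MvPolynomial σ A) (q : MvPolynomial σ P), p = MvPolynomial.map j r + C b * q := by
  induction p using MvPolynomial.induction_on' with
  | monomial m c =>
    obtain ⟨r, q, rfl⟩ := h c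
    exact ⟨monomial m r, monomial m q, by rw [map_monomial, C_mul_monomial, map_add]⟩
  | add p q hp hq =>
    obtain ⟨r, s, rfl⟩ := hp
    obtain ⟨r', s', rfl⟩ := hq
    exact ⟨r + r', s + s', by rw [map_add]; ring⟩

theorem MvPolynomial.C_dvd_of_C_dvd_map {σ A P : Type*} [CommRing A] [CommRing P]
    (j : A →+* P) (a : A) (b : P) (h : ∀ r : A, b ∣ j r → a ∣ r) (r : MvPolynomial σ A)
    (hr : C b ∣ MvPolynomial.map j r) : C a ∣ r := by
  rw [C_dvd_iff_dvd_coeff] at hr ⊢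
  exact fun m => h _ (by simpa [coeff_map] using hr m)

theorem PowerSeries.exists_eq_coe_add_X_pow_mul {K : Type*} [CommRing K] (k : ℕ)
    (p : PowerSeries K) :
    ∃ (r : Polynomial K) (q : PowerSeries K), p = (r : PowerSeries K) + X ^ k * q := by
  have h : (X : PowerSeries K) ^ k ∣ p - (trunc k p : PowerSeries K) := by
    rw [X_pow_dvd_iff]
    intro m hm
    simp [coeff_trunc, hm]
  obtain ⟨q, hq⟩ := h
  exact ⟨trunc k p, q, by rw [← hq]; ring⟩

theorem X_pow_dvd_of_X_pow_dvd_powerSeries {K : Type*} [Field K]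
    (A : Type*) [CommRing A] [Algebra (Polynomial K) A]
    [IsLocalization (constUnitSubmonoid K) A]
    (j : A →+* PowerSeries K)
    (hj : ∀ p : Polynomial K,
      j (algebraMap (Polynomial K) A p) = Polynomial.coeToPowerSeries.ringHom p)
    (k : ℕ) (r : A) (h : (PowerSeries.X : PowerSeries K) ^ k ∣ j r) :
    algebraMap (Polynomial K) A Polynomial.X ^ k ∣ r := by
  obtain ⟨⟨p, s⟩, hp⟩ := IsLocalization.surj (constUnitSubmonoid K) r
  have hs : IsUnit (algebraMap (Polynomial K) A s) := IsLocalization.map_units A s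
  have hjp : (PowerSeries.X : PowerSeries K) ^ k ∣ (p : PowerSeries K) := by
    rw [← Polynomial.coeToPowerSeries.ringHom_apply, ← hj, ← hp, map_mul]
    exact h.mul_right _
  have hX : (Polynomial.X : Polynomial K) ^ k ∣ p := by
    rw [PowerSeries.X_pow_dvd_iff] at hjp
    rw [Polynomial.X_pow_dvd_iff]
    simpa using hjp
  rw [← hs.dvd_mul_right, hp, ← map_pow]
  exact map_dvd _ hX

/-- **Proposition.**  Let `f_1,…,f_k ∈ K[t,x]` and let `I = ⟨f_1,…,f_k⟩` be the ideal
they generate in `K[t]_{⟨t⟩}[x]` (modelled by an arbitrary localization `A` of `K[t]`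
at `K[t] ∖ ⟨t⟩`).  Let `ι = MvPolynomial.map j : K[t]_{⟨t⟩}[x] → K[[t]][x]` be induced
by the canonical map `j : K[t]_{⟨t⟩} → K[[t]]` (the unique ring homomorphism compatible
with the inclusion `K[t] → K[[t]]`).  Then
`⟨ι(I)⟩ : ⟨t⟩^∞ = ⟨ι(I : ⟨t⟩^∞)⟩` in `K[[t]][x]`. -/
theorem statement19 {K : Type*} [Field K] {n k : ℕ}
    (A : Type*) [CommRing A] [Algebra (Polynomial K) A]
    [IsLocalization (constUnitSubmonoid K) A]
    (j : A →+* PowerSeries K)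
    (hj : ∀ p : Polynomial K,
      j (algebraMap (Polynomial K) A p) = Polynomial.coeToPowerSeries.ringHom p)
    (f : Fin k → MvPolynomial (Fin n) (Polynomial K)) :
    satIdeal
      (Ideal.map (MvPolynomial.map j)
        (Ideal.span (Set.range
          (fun i => MvPolynomial.map (algebraMap (Polynomial K) A) (f i)))))
      (MvPolynomial.C PowerSeries.X)
    = Ideal.map (MvPolynomial.map j)
        (satIdeal
          (Ideal.span (Set.range
            (fun i => MvPolynomial.map (algebraMap (Polynomial K) A) (f i))))
          (MvPolynomial.C (algebraMap (Polynomial K) A Polynomial.X))) := by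
  have hjX : j (algebraMap (Polynomial K) A Polynomial.X) = PowerSeries.X := by
    rw [hj, Polynomial.coeToPowerSeries.ringHom_apply, Polynomial.coe_X]
  have hX : MvPolynomial.map (σ := Fin n) j
      (MvPolynomial.C (algebraMap (Polynomial K) A Polynomial.X)) =
        MvPolynomial.C PowerSeries.X := by
    rw [MvPolynomial.map_C, hjX]
  rw [← hX]
  apply satIdeal_map_eq_map_satIdeal
  · rw [hX]
    exact IsLeftCancelMulZero.mul_left_cancel_of_ne_zero
      ((MvPolynomial.C_injective _ _).ne_iff' (map_zero _) |>.2 PowerSeries.X_ne_zero)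
  · intro m p
    rw [hX, ← map_pow]
    refine MvPolynomial.exists_eq_map_add_C_mul j _ (fun c => ?_) p
    obtain ⟨r, q, hrq⟩ := PowerSeries.exists_eq_coe_add_X_pow_mul m c
    exact ⟨algebraMap (Polynomial K) A r, q, by
      rw [hj, Polynomial.coeToPowerSeries.ringHom_apply, ← hrq]⟩
  · intro m r hr
    rw [hX, ← map_pow] at hr
    rw [← map_pow]
    exact MvPolynomial.C_dvd_of_C_dvd_map j _ _
      (X_pow_dvd_of_X_pow_dvd_powerSeries A j hj m) r hr
end
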